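/- arXiv:2202.08581 — 2 statements merged into one kernel-verified Lean document; each statement's English description precedes it below -/
import Mathlib

section
/- Let ρ₁₂, ρ₁₃, ρ₁₄, ρ₂₃, ρ₂₄, ρ₃₄ be d×d complex positive semidefinite matrices with trace 1 satisfying the operational equivalences ρ₁₂ + ρ₁₃ = ρ₁₄ + ρ₂₃ = ρ₂₄ + ρ₃₄, and for each k ∈ {1,2,3,4} let (M_k(l))_{l ∈ {1,2,3,4}\{k}} be a POVM on ℂ^d (three positive semidefinite matrices summing to the identity, with outcomes labeled by the elements of {1,2,3,4} other than k). Then the T_{4,2} success metric Σ_k Σ_{l ≠ k} tr(ρ_{mn} M_k(l)) — where for each (k, l) with l ≠ k, {m, n} = {1,2,3,4} \ {k, l} — satisfies Σ ≤ 8. -/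
open Matrix ComplexOrder

open scoped MatrixOrder in
/-- The trace of a product of two positive semidefinite matrices has nonnegative real part. -/
theorem re_trace_mul_nonneg_of_posSemidef {n : Type*} [Fintype n]
    {A B : Matrix n n ℂ} (hA : A.PosSemidef) (hB : B.PosSemidef) :
    0 ≤ (Matrix.trace (A * B)).re := by
  classical
  obtain ⟨C, rfl⟩ := CStarAlgebra.nonneg_iff_eq_star_mul_self.mp hB.nonneg
  rw [← Matrix.mul_assoc, Matrix.trace_mul_comm, ← Matrix.mul_assoc]
  exact (Complex.le_def.mp (hA.mul_mul_conjTranspose_same C).trace_nonneg).1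

/-- If `T` dominates every matrix `A l` in the Loewner order, then the success metric of any
POVM for discriminating the `A l` is at most the trace of `T`. -/
theorem sum_re_trace_mul_le_re_trace {ι n : Type*} [Fintype n] [DecidableEq n]
    {s : Finset ι} {A M : ι → Matrix n n ℂ} {T : Matrix n n ℂ}
    (hA : ∀ l ∈ s, (T - A l).PosSemidef) (hM : ∀ l ∈ s, (M l).PosSemidef)
    (hMsum : ∑ l ∈ s, M l = 1) :
    ∑ l ∈ s, (Matrix.trace (A l * M l)).re ≤ (Matrix.trace T).re := by
  calc ∑ l ∈ s, (Matrix.trace (A l * M l)).re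
      ≤ ∑ l ∈ s, (Matrix.trace (T * M l)).re := by
        refine Finset.sum_le_sum fun l hl => ?_
        have h := re_trace_mul_nonneg_of_posSemidef (hA l hl) (hM l hl)
        rw [Matrix.sub_mul, Matrix.trace_sub, Complex.sub_re] at h
        linarith
    _ = (Matrix.trace T).re := by
        rw [← Complex.re_sum, ← Matrix.trace_sum, ← Matrix.mul_sum, hMsum, Matrix.mul_one]

/-- If the six density matrices `ρ_{ij}` on `ℂ^d` (here `σ s` for the 2-element subsets
`s ⊆ Fin 4`) satisfy the operational equivalences `ρ₁₂ + ρ₁₃ = ρ₁₄ + ρ₂₃ = ρ₂₄ + ρ₃₄`, and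
for each `k` the matrices `(M k l)_{l ≠ k}` form a POVM on `ℂ^d`, then the `T_{4,2}`
success metric `Σ_k Σ_{l ≠ k} tr(ρ_{mn} M_k(l))`, where `{m, n}` is the complement of
`{k, l}` in `Fin 4`, is at most `8`. -/
theorem T42_noncontextual_outer_bound {d : ℕ}
    (σ : Finset (Fin 4) → Matrix (Fin d) (Fin d) ℂ)
    (hpsd : ∀ s : Finset (Fin 4), s.card = 2 → (σ s).PosSemidef)
    (htr : ∀ s : Finset (Fin 4), s.card = 2 → Matrix.trace (σ s) = 1)
    (hop1 : σ {0, 1} + σ {0, 2} = σ {0, 3} + σ {1, 2})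
    (hop2 : σ {0, 3} + σ {1, 2} = σ {1, 3} + σ {2, 3})
    (M : Fin 4 → Fin 4 → Matrix (Fin d) (Fin d) ℂ)
    (hM : ∀ k l, l ≠ k → (M k l).PosSemidef)
    (hMsum : ∀ k, ∑ l ∈ Finset.univ.erase k, M k l = 1) :
    ∑ k : Fin 4, ∑ l ∈ Finset.univ.erase k,
        (Matrix.trace (σ (({k, l} : Finset (Fin 4))ᶜ) * M k l)).re ≤ 8 := by
  have hT : ∀ s : Finset (Fin 4), s.card = 2 → (σ {0, 1} + σ {0, 2} - σ s).PosSemidef := by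
    intro s hs
    have hcases : s = {0, 1} ∨ s = {0, 2} ∨ s = {0, 3} ∨ s = {1, 2} ∨ s = {1, 3} ∨ s = {2, 3} := by
      revert s
      decide
    rcases hcases with rfl | rfl | rfl | rfl | rfl | rfl
    · simpa using hpsd {0, 2} rfl
    · simpa using hpsd {0, 1} rfl
    · simpa [hop1] using hpsd {1, 2} rfl
    · simpa [hop1] using hpsd {0, 3} rfl
    · simpa [hop1, hop2] using hpsd {2, 3} rfl
    · simpa [hop1, hop2] using hpsd {1, 3} rfl
  have hcard : ∀ k l : Fin 4, l ≠ k → (({k, l} : Finset (Fin 4))ᶜ).card = 2 := by decide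
  have htrT : (Matrix.trace (σ {0, 1} + σ {0, 2})).re = 2 := by
    rw [Matrix.trace_add, htr {0, 1} rfl, htr {0, 2} rfl]
    norm_num
  calc ∑ k : Fin 4, ∑ l ∈ Finset.univ.erase k,
        (Matrix.trace (σ (({k, l} : Finset (Fin 4))ᶜ) * M k l)).re
      ≤ ∑ _k : Fin 4, (2 : ℝ) := Finset.sum_le_sum fun k _ => htrT ▸
        sum_re_trace_mul_le_re_trace
          (fun l hl => hT _ (hcard k l (Finset.ne_of_mem_erase hl)))
          (fun l hl => hM k l (Finset.ne_of_mem_erase hl)) (hMsum k)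
    _ = 8 := by norm_num
end

section
/- Let ρ₁₂, ρ₁₃, ρ₁₄, ρ₂₃, ρ₂₄, ρ₃₄ be arbitrary 2×2 complex positive semidefinite matrices with trace 1 (qubit states, with no operational equivalence assumed), and for each k ∈ {1,2,3,4} let (M_k(l))_{l ∈ {1,2,3,4}\{k}} be a POVM on ℂ² (three 2×2 positive semidefinite matrices summing to the identity). Then the T_{4,2} success metric Σ_k Σ_{l ≠ k} tr(ρ_{mn} M_k(l)) — where for each (k, l) with l ≠ k, {m, n} = {1,2,3,4} \ {k, l} — satisfies Σ ≤ 8. Hence the outer bound on the task T_{4,2} for qubits is 8, the same value as achieved by one classical bit. -/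
open Matrix ComplexOrder

open scoped MatrixOrder Matrix.Norms.L2Operator in
theorem Matrix.PosSemidef.exists_eq_conjTranspose_mul_self {n : Type*} [Fintype n]
    [DecidableEq n] {A : Matrix n n ℂ} (hA : A.PosSemidef) :
    ∃ C : Matrix n n ℂ, A = Cᴴ * C :=
  CStarAlgebra.nonneg_iff_eq_star_mul_self.mp hA.nonneg

open scoped Matrix.Norms.Frobenius in
theorem Matrix.re_trace_mul_conjTranspose_self {n : Type*} [Fintype n] (C : Matrix n n ℂ) :
    (trace (C * Cᴴ)).re = ‖C‖ ^ 2 := by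
  have h : 0 ≤ ∑ i, ∑ j, ‖C i j‖ ^ (2 : ℝ) := by positivity
  rw [frobenius_norm_def, ← Real.rpow_natCast, ← Real.rpow_mul h]
  simp [trace, mul_apply, Complex.mul_conj, Complex.normSq_eq_norm_sq, -Complex.ofReal_pow]

open scoped Matrix.Norms.Frobenius in
/-- The trace is submultiplicative on positive semidefinite matrices. -/
theorem Matrix.PosSemidef.re_trace_mul_le {n : Type*} [Fintype n] [DecidableEq n]
    {A B : Matrix n n ℂ} (hA : A.PosSemidef) (hB : B.PosSemidef) :
    (trace (A * B)).re ≤ (trace A).re * (trace B).re := by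
  obtain ⟨C, rfl⟩ := hA.exists_eq_conjTranspose_mul_self
  obtain ⟨D, rfl⟩ := hB.exists_eq_conjTranspose_mul_self
  have h : trace (Cᴴ * C * (Dᴴ * D)) = trace (C * Dᴴ * (C * Dᴴ)ᴴ) := by
    rw [conjTranspose_mul, conjTranspose_conjTranspose, Matrix.mul_assoc, trace_mul_comm]
    simp only [Matrix.mul_assoc]
  rw [h, trace_mul_comm Cᴴ C, trace_mul_comm Dᴴ D, re_trace_mul_conjTranspose_self,
    re_trace_mul_conjTranspose_self, re_trace_mul_conjTranspose_self, ← mul_pow]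
  have := frobenius_norm_mul C Dᴴ
  rw [frobenius_norm_conjTranspose] at this
  gcongr

/-- For arbitrary qubit states `ρ_{ij}` (here `σ s` for the 2-element subsets `s ⊆ Fin 4`,
with no operational equivalence assumed) and, for each `k`, a POVM `(M k l)_{l ≠ k}` on
`ℂ²`, the `T_{4,2}` success metric `Σ_k Σ_{l ≠ k} tr(ρ_{mn} M_k(l))`, where `{m, n}` is the
complement of `{k, l}` in `Fin 4`, is at most `8` — the same value as achieved by one
classical bit. -/
theorem T42_qubit_outer_bound
    (σ : Finset (Fin 4) → Matrix (Fin 2) (Fin 2) ℂ)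
    (hpsd : ∀ s : Finset (Fin 4), s.card = 2 → (σ s).PosSemidef)
    (htr : ∀ s : Finset (Fin 4), s.card = 2 → Matrix.trace (σ s) = 1)
    (M : Fin 4 → Fin 4 → Matrix (Fin 2) (Fin 2) ℂ)
    (hM : ∀ k l, l ≠ k → (M k l).PosSemidef)
    (hMsum : ∀ k, ∑ l ∈ Finset.univ.erase k, M k l = 1) :
    ∑ k : Fin 4, ∑ l ∈ Finset.univ.erase k,
        (Matrix.trace (σ (({k, l} : Finset (Fin 4))ᶜ) * M k l)).re ≤ 8 := by
  have key : ∀ k : Fin 4, ∑ l ∈ Finset.univ.erase k,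
      (trace (σ (({k, l} : Finset (Fin 4))ᶜ) * M k l)).re ≤ 2 := by
    intro k
    calc _ ≤ ∑ l ∈ Finset.univ.erase k, (trace (M k l)).re := by
          refine Finset.sum_le_sum fun l hl => ?_
          have hlk : l ≠ k := Finset.ne_of_mem_erase hl
          have hc : (({k, l} : Finset (Fin 4))ᶜ).card = 2 := by
            rw [Finset.card_compl, Finset.card_pair hlk.symm, Fintype.card_fin]
          have h := (hpsd _ hc).re_trace_mul_le (hM k l hlk)
          rwa [htr _ hc, Complex.one_re, one_mul] at h
      _ = 2 := by
          rw [← Complex.re_sum, ← trace_sum, hMsum]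
          simp
  calc _ ≤ ∑ _k : Fin 4, (2 : ℝ) := Finset.sum_le_sum fun k _ => key k
    _ = 8 := by norm_num
end
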